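/- Let p be a prime and k ≥ 2 an integer. Let a₁, …, a_k be pairwise distinct p-adic integers with a_i ≡ 1 (mod p) for each i; in the case p = 2 assume additionally that a_i ≠ −a_j for all i, j. Let c₁, …, c_k be nonzero p-adic numbers. Suppose f : ℤ_p → ℚ_p is continuous with f(n) = ∑_{i=1}^k c_i·a_i^n for every natural number n, and suppose f(x₀) = 0 for some x₀ ∈ ℤ_p. Then there exist an integer α, a positive integer l with l < k, and a natural number m such that for every t ∈ ℤ_p with t ≡ x₀ (mod p^m) and t ≠ x₀ one has v_p(f(t)) = α + l·v_p(t − x₀). In particular, x₀ is an isolated zero of f. -/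

import Mathlib

open scoped Classical

/-- `p`-adic valuation of a `p`-adic number, with `v_p(0) = ⊤`. -/
noncomputable def vpQp (p : ℕ) [Fact p.Prime] (x : ℚ_[p]) : WithTop ℤ :=
  if x = 0 then ⊤ else (x.valuation : WithTop ℤ)

/-- `p`-adic valuation of a `p`-adic integer, with `v_p(0) = ⊤`. -/
noncomputable def vpZp (p : ℕ) [Fact p.Prime] (x : ℤ_[p]) : WithTop ℤ :=
  if x = 0 then ⊤ else (x.valuation : WithTop ℤ)

open Polynomial in
lemma PadicInt.norm_eval_sub_sum_coeff_le {p : ℕ} [Fact p.Prime] (P : ℤ_[p][X]) (K : ℕ)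
    (y : ℤ_[p]) :
    ‖P.eval y - ∑ n ∈ Finset.range K, P.coeff n * y ^ n‖ ≤ ‖y‖ ^ K := by
  rw [Polynomial.eval_eq_sum_range' (n := K + (P.natDegree + 1)) (by omega), Finset.sum_range_add,
    add_sub_cancel_left]
  simp_rw [pow_add, mul_left_comm _ (y ^ K)]
  rw [← Finset.mul_sum, norm_mul, norm_pow]
  exact mul_le_of_le_one_right (by positivity) (PadicInt.norm_le_one _)

lemma PadicInt.norm_pow_div_factorial_le {p : ℕ} [Fact p.Prime] {u : ℤ_[p]}
    (hu : (p : ℤ_[p]) ^ 2 ∣ u) (j : ℕ) :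
    ‖(u : ℚ_[p]) ^ j / (j.factorial : ℚ_[p])‖ ≤ ((p : ℝ)⁻¹) ^ j := by
  have hp : (0 : ℝ) < p := by exact_mod_cast (Fact.out : p.Prime).pos
  have hp1 : (1 : ℝ) ≤ p := by exact_mod_cast (Fact.out : p.Prime).one_le
  have h1 : ‖u‖ ≤ ((p : ℝ)⁻¹) ^ 2 := by
    obtain ⟨w, rfl⟩ := hu
    simp only [norm_mul, norm_pow, PadicInt.norm_p]
    exact mul_le_of_le_one_right (by positivity) (PadicInt.norm_le_one _)
  have h2 : ((p : ℝ)⁻¹) ^ j ≤ ‖(j.factorial : ℚ_[p])‖ := by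
    rw [Padic.norm_eq_zpow_neg_valuation (by exact_mod_cast j.factorial_ne_zero),
      Padic.valuation_natCast, inv_pow, ← zpow_natCast, ← zpow_neg]
    apply zpow_le_zpow_right₀ hp1
    have := sub_one_mul_padicValNat_factorial (p := p) j
    have h3 : 1 ≤ p - 1 := by have := (Fact.out : p.Prime).two_le; omega
    have h4 : padicValNat p j.factorial ≤ j := by nlinarith [Nat.sub_le j (p.digits j).sum]
    omega
  rw [norm_div, norm_pow, div_le_iff₀ (lt_of_lt_of_le (by positivity) h2)]
  calc ‖(u : ℚ_[p])‖ ^ j ≤ (((p : ℝ)⁻¹) ^ 2) ^ j := by gcongr; simpa using h1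
    _ = ((p : ℝ)⁻¹) ^ j * ((p : ℝ)⁻¹) ^ j := by ring
    _ ≤ _ := by gcongr

/-- `g` has a Taylor expansion at `0` with coefficients `A`, with remainders bounded uniformly. -/
def HasTaylorBound {p : ℕ} [Fact p.Prime] (g : ℤ_[p] → ℚ_[p]) (A : ℕ → ℚ_[p]) (C : ℝ) : Prop :=
  ∀ (K : ℕ) (y : ℤ_[p]), ‖g y - ∑ n ∈ Finset.range K, A n * (y : ℚ_[p]) ^ n‖ ≤ C * ‖y‖ ^ K

lemma exists_continuous_hasTaylorBound_pow {p : ℕ} [Fact p.Prime] {b : ℤ_[p]}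
    (hb : (p : ℤ_[p]) ^ 2 ∣ b - 1) :
    ∃ φ : ℤ_[p] → ℚ_[p], Continuous φ ∧ (∀ n : ℕ, φ n = (b : ℚ_[p]) ^ n) ∧
      ∃ A C, HasTaylorBound φ A C := by
  set u := b - 1 with hu
  set T : ℕ → ℚ_[p] := fun j => (u : ℚ_[p]) ^ j / (j.factorial : ℚ_[p]) with hTdef
  have hT : ∀ j, ‖T j‖ ≤ ((p : ℝ)⁻¹) ^ j := PadicInt.norm_pow_div_factorial_le hb
  have hp1 : (1 : ℝ) < p := by exact_mod_cast (Fact.out : p.Prime).one_lt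
  have hgeo := hasSum_geometric_of_lt_one (r := (p : ℝ)⁻¹) (by positivity)
    (inv_lt_one_of_one_lt₀ hp1)
  have hbd : ∀ (z : ℕ → ℤ_[p]) j, ‖T j * (z j : ℚ_[p])‖ ≤ ((p : ℝ)⁻¹) ^ j := fun z j => by
    rw [norm_mul]
    exact (mul_le_of_le_one_right (norm_nonneg _) (z j).norm_le_one).trans (hT j)
  have hsum : ∀ z : ℕ → ℤ_[p], Summable fun j => T j * (z j : ℚ_[p]) := fun z =>
    Summable.of_norm_bounded hgeo.summable (hbd z)
  let D : ℕ → Polynomial ℤ_[p] := fun j => descPochhammer ℤ_[p] j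
  refine ⟨fun y => ∑' j, T j * (((D j).eval y : ℤ_[p]) : ℚ_[p]), ?_, ?_,
    fun n => ∑' j, T j * (((D j).coeff n : ℤ_[p]) : ℚ_[p]), (1 - (p : ℝ)⁻¹)⁻¹, ?_⟩
  · refine continuous_tsum (fun j => ?_) hgeo.summable
      (fun j y => hbd (fun j => (D j).eval y) j)
    exact continuous_const.mul (continuous_subtype_val.comp (D j).continuous)
  · intro n
    have hb1 : (b : ℚ_[p]) = (u : ℚ_[p]) + 1 := by rw [hu]; push_cast; ring
    beta_reduce
    rw [tsum_eq_sum (s := Finset.range (n + 1)), hb1, add_pow]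
    · refine Finset.sum_congr rfl fun j _ => ?_
      have hj : (j.factorial : ℚ_[p]) ≠ 0 := by exact_mod_cast j.factorial_ne_zero
      simp only [D, hTdef, descPochhammer_eval_eq_descFactorial,
        Nat.descFactorial_eq_factorial_mul_choose]
      push_cast
      field_simp
      simp
    · intro j hj
      simp only [Finset.mem_range, not_lt] at hj
      simp [D, descPochhammer_eval_eq_descFactorial, Nat.descFactorial_of_lt (show n < j by omega)]
  · intro K y
    have key : ∑' j, T j * (((D j).eval y : ℤ_[p]) : ℚ_[p]) -
        ∑ n ∈ Finset.range K, (∑' j, T j * (((D j).coeff n : ℤ_[p]) : ℚ_[p])) * (y : ℚ_[p]) ^ n =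
        ∑' j, T j * (((D j).eval y - ∑ n ∈ Finset.range K, (D j).coeff n * y ^ n : ℤ_[p]) :
          ℚ_[p]) := by
      simp_rw [← tsum_mul_right]
      rw [← Summable.tsum_finsetSum fun n _ => (hsum fun j => (D j).coeff n).mul_right _,
        ← Summable.tsum_sub (hsum _)
          (summable_sum fun n _ => (hsum fun j => (D j).coeff n).mul_right _)]
      refine tsum_congr fun j => ?_
      rw [PadicInt.coe_sub, PadicInt.coe_sum, mul_sub, Finset.mul_sum]
      push_cast
      simp_rw [mul_assoc]
    rw [key]
    refine tsum_of_norm_bounded (hgeo.mul_right _) fun j => ?_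
    rw [norm_mul]
    exact mul_le_mul (hT j) (PadicInt.norm_eval_sub_sum_coeff_le _ _ _) (norm_nonneg _)
      (by positivity)

lemma exists_hasTaylorBound_expSum {p : ℕ} [Fact p.Prime] {ι : Type*} [Fintype ι]
    {b : ι → ℤ_[p]} (hb : ∀ i, (p : ℤ_[p]) ^ 2 ∣ b i - 1) (d : ι → ℚ_[p])
    {g : ℤ_[p] → ℚ_[p]} (hg : Continuous g)
    (hgn : ∀ n : ℕ, g n = ∑ i, d i * (b i : ℚ_[p]) ^ n) :
    ∃ A C, HasTaylorBound g A C := by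
  choose φ hφ hφn A C hAC using fun i => exists_continuous_hasTaylorBound_pow (hb i)
  have hgφ : g = fun y => ∑ i, d i * φ i y := by
    refine PadicInt.denseRange_natCast.equalizer hg
      (continuous_finsetSum _ fun i _ => continuous_const.mul (hφ i)) (funext fun n => ?_)
    simp [hgn, hφn]
  refine ⟨fun n => ∑ i, d i * A i n, ∑ i, ‖d i‖ * C i, fun K y => ?_⟩
  have : g y - ∑ n ∈ Finset.range K, (∑ i, d i * A i n) * (y : ℚ_[p]) ^ n =
      ∑ i, d i * (φ i y - ∑ n ∈ Finset.range K, A i n * (y : ℚ_[p]) ^ n) := by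
    simp_rw [hgφ, mul_sub, Finset.sum_sub_distrib, Finset.mul_sum, Finset.sum_mul]
    rw [Finset.sum_comm]
    simp_rw [mul_assoc]
  rw [this, Finset.sum_mul]
  refine norm_sum_le_of_le _ fun i _ => ?_
  rw [norm_mul, mul_assoc]
  exact mul_le_mul_of_nonneg_left (hAC i K y) (norm_nonneg _)

lemma PadicInt.norm_pow_prime_sub_pow_prime {p : ℕ} [Fact p.Prime] {x y : ℤ_[p]}
    (hx : (p : ℤ_[p]) ^ 2 ∣ x - 1) (hy : (p : ℤ_[p]) ^ 2 ∣ y - 1) :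
    ‖x ^ p - y ^ p‖ = ‖(p : ℤ_[p])‖ * ‖x - y‖ := by
  have h : (p : ℤ_[p]) ^ 2 ∣ ∑ i ∈ Finset.range p, x ^ i * y ^ (p - 1 - i) - p := by
    have : ∑ i ∈ Finset.range p, x ^ i * y ^ (p - 1 - i) - (p : ℤ_[p]) =
        ∑ i ∈ Finset.range p, (x ^ i * y ^ (p - 1 - i) - 1) := by simp
    rw [this]
    refine Finset.dvd_sum fun i _ => ?_
    have e : x ^ i * y ^ (p - 1 - i) - 1 =
        (x ^ i - 1) * y ^ (p - 1 - i) + (y ^ (p - 1 - i) - 1) := by ring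
    rw [e]
    exact dvd_add ((hx.trans (sub_one_dvd_pow_sub_one x i)).mul_right _)
      (hy.trans (sub_one_dvd_pow_sub_one y _))
  obtain ⟨w, hw⟩ := h
  have hw' : ∑ i ∈ Finset.range p, x ^ i * y ^ (p - 1 - i) = (p : ℤ_[p]) * (1 + p * w) := by
    linear_combination hw
  have hunit : ‖1 + (p : ℤ_[p]) * w‖ = 1 := by
    have hlt : ‖(p : ℤ_[p]) * w‖ < 1 := (PadicInt.norm_lt_one_iff_dvd _).2 (dvd_mul_right _ _)
    rw [IsUltrametricDist.norm_add_eq_max_of_norm_ne_norm (by rw [norm_one]; exact hlt.ne'),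
      norm_one, max_eq_left hlt.le]
  rw [← geom_sum₂_mul, hw', norm_mul, norm_mul, hunit, mul_one]

lemma PadicInt.norm_pow_prime_pow_sub {p : ℕ} [Fact p.Prime] {x y : ℤ_[p]}
    (hx : (p : ℤ_[p]) ^ 2 ∣ x - 1) (hy : (p : ℤ_[p]) ^ 2 ∣ y - 1) (N : ℕ) :
    ‖x ^ p ^ N - y ^ p ^ N‖ = ‖(p : ℤ_[p])‖ ^ N * ‖x - y‖ := by
  induction N with
  | zero => simp
  | succ N ih =>
    rw [pow_succ p N, pow_mul, pow_mul, PadicInt.norm_pow_prime_sub_pow_prime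
      (hx.trans (sub_one_dvd_pow_sub_one x _)) (hy.trans (sub_one_dvd_pow_sub_one y _)), ih]
    ring

lemma PadicInt.sq_dvd_pow_prime_sub_one {p : ℕ} [Fact p.Prime] {x : ℤ_[p]}
    (hx : (p : ℤ_[p]) ∣ x - 1) : (p : ℤ_[p]) ^ 2 ∣ x ^ p - 1 := by
  have h : (p : ℤ_[p]) ∣ ∑ i ∈ Finset.range p, x ^ i := by
    have : ∑ i ∈ Finset.range p, x ^ i = ∑ i ∈ Finset.range p, (x ^ i - 1) + (p : ℤ_[p]) := by simp
    rw [this]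
    exact dvd_add (Finset.dvd_sum fun i _ => hx.trans (sub_one_dvd_pow_sub_one x i)) dvd_rfl
  rw [← geom_sum_mul, sq]
  exact mul_dvd_mul h hx

lemma PadicInt.pow_prime_ne_pow_prime {p : ℕ} [Fact p.Prime] {x y : ℤ_[p]}
    (hx : (p : ℤ_[p]) ∣ x - 1) (hy : (p : ℤ_[p]) ∣ y - 1) (hxy : x ≠ y)
    (h2 : p = 2 → x ≠ -y) : x ^ p ≠ y ^ p := by
  intro h
  have hpp : p.Prime := Fact.out
  rcases hpp.eq_two_or_odd' with h2' | hodd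
  · subst h2'
    rcases sq_eq_sq_iff_eq_or_eq_neg.1 h with h | h
    exacts [hxy h, h2 rfl h]
  · have hp0 : (p : ℤ_[p]) ≠ 0 := by exact_mod_cast hpp.ne_zero
    obtain ⟨w, hw⟩ : (p : ℤ_[p]) ∣ x - y := by simpa using dvd_sub hx hy
    have hdvd := odd_sq_dvd_geom_sum₂_sub y w hodd
    rw [← hw, add_sub_cancel] at hdvd
    have h0 : ∑ i ∈ Finset.range p, x ^ i * y ^ (p - 1 - i) = 0 := by
      have := geom_sum₂_mul x y p
      rw [h, sub_self] at this
      exact (mul_eq_zero.1 this).resolve_right (sub_ne_zero.2 hxy)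
    rw [h0, zero_sub, dvd_neg, sq, mul_dvd_mul_iff_left hp0] at hdvd
    have hy' := hdvd.sub (hy.trans (sub_one_dvd_pow_sub_one y (p - 1)))
    rw [sub_sub_cancel] at hy'
    exact PadicInt.prime_p.not_isUnit (isUnit_of_dvd_one hy')

open Polynomial in
lemma norm_coeff_mul_prod_le {p : ℕ} [Fact p.Prime] {k : ℕ} (β : Fin k → ℤ_[p])
    (d : Fin k → ℚ_[p]) {M : ℝ} (hM : 0 ≤ M)
    (h : ∀ n < k, ‖∑ i, d i * (β i : ℚ_[p]) ^ n‖ ≤ M) (i : Fin k) :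
    ‖d i‖ * ∏ j ∈ Finset.univ.erase i, ‖β i - β j‖ ≤ M := by
  set P : ℤ_[p][X] := ∏ j ∈ Finset.univ.erase i, (X - C (β j)) with hP
  have hdeg : P.natDegree < k := by
    have := i.pos
    rw [hP, natDegree_finsetProd_X_sub_C_eq_card, Finset.card_erase_of_mem (Finset.mem_univ _),
      Finset.card_univ, Fintype.card_fin]
    omega
  have hP0 : ∀ j ≠ i, P.eval (β j) = 0 := fun j hj => by
    rw [hP, eval_prod]
    exact Finset.prod_eq_zero (Finset.mem_erase.2 ⟨hj, Finset.mem_univ j⟩) (by simp)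
  have e : ∑ n ∈ Finset.range k, ((P.coeff n : ℤ_[p]) : ℚ_[p]) * ∑ j, d j * (β j : ℚ_[p]) ^ n =
      d i * ((P.eval (β i) : ℤ_[p]) : ℚ_[p]) := by
    have e1 : ∀ j, d j * ((P.eval (β j) : ℤ_[p]) : ℚ_[p]) =
        ∑ n ∈ Finset.range k, ((P.coeff n : ℤ_[p]) : ℚ_[p]) * (d j * (β j : ℚ_[p]) ^ n) := by
      intro j
      rw [eval_eq_sum_range' hdeg, PadicInt.coe_sum, Finset.mul_sum]
      exact Finset.sum_congr rfl fun n _ => by push_cast; ring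
    simp_rw [Finset.mul_sum]
    rw [Finset.sum_comm]
    simp_rw [← e1]
    refine Finset.sum_eq_single i (fun j _ hj => ?_) (by simp)
    simp [hP0 j hj]
  have e2 : ‖P.eval (β i)‖ = ∏ j ∈ Finset.univ.erase i, ‖β i - β j‖ := by
    simp [hP, eval_prod, norm_prod]
  rw [← e2, PadicInt.norm_def, ← norm_mul, ← e]
  refine IsUltrametricDist.norm_sum_le_of_forall_le_of_nonneg hM fun n hn => ?_
  rw [norm_mul]
  exact (mul_le_of_le_one_left (norm_nonneg _) (PadicInt.norm_le_one _)).trans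
    (h n (Finset.mem_range.1 hn))

lemma not_norm_expSum_le {p : ℕ} [Fact p.Prime] {k : ℕ} (hk : 0 < k) {b : Fin k → ℤ_[p]}
    (hinj : Function.Injective b) (hb : ∀ i, (p : ℤ_[p]) ^ 2 ∣ b i - 1) {d : Fin k → ℚ_[p]}
    (hd : ∀ i, d i ≠ 0) {g : ℤ_[p] → ℚ_[p]}
    (hgn : ∀ n : ℕ, g n = ∑ i, d i * (b i : ℚ_[p]) ^ n) (C : ℝ) :
    ¬ ∀ y, ‖g y‖ ≤ C * ‖y‖ ^ k := by
  intro hC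
  have hC0 : 0 ≤ C := by simpa using (norm_nonneg _).trans (hC 1)
  let i : Fin k := ⟨0, hk⟩
  set E : ℝ := ‖d i‖ * ∏ j ∈ Finset.univ.erase i, ‖b i - b j‖ with hE
  have hE0 : 0 < E := mul_pos (norm_pos_iff.2 (hd i)) <| Finset.prod_pos fun j hj =>
    norm_pos_iff.2 (sub_ne_zero.2 (hinj.ne (Finset.ne_of_mem_erase hj).symm))
  have hp0 : 0 < ‖(p : ℤ_[p])‖ := norm_pos_iff.2 PadicInt.prime_p.ne_zero
  have key : ∀ N : ℕ, E ≤ C * ‖(p : ℤ_[p])‖ ^ N := by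
    intro N
    have h := norm_coeff_mul_prod_le (fun i => b i ^ p ^ N) d
      (M := C * (‖(p : ℤ_[p])‖ ^ N) ^ k) (by positivity) (fun n _ => ?_) i
    · simp_rw [PadicInt.norm_pow_prime_pow_sub (hb _) (hb _)] at h
      rw [Finset.prod_mul_distrib, Finset.prod_const, Finset.card_erase_of_mem (Finset.mem_univ _),
        Finset.card_univ, Fintype.card_fin, mul_left_comm, ← hE, ← mul_pow_sub_one hk.ne' (_ ^ N)] at h
      have hpos : 0 < (‖(p : ℤ_[p])‖ ^ N) ^ (k - 1) := by positivity
      refine le_of_mul_le_mul_left (h.trans_eq ?_) hpos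
      ring
    · have e : ∑ i, d i * ((b i ^ p ^ N : ℤ_[p]) : ℚ_[p]) ^ n = g ((p ^ N * n : ℕ) : ℤ_[p]) := by
        rw [hgn]
        push_cast
        simp_rw [pow_mul]
      rw [e]
      refine (hC _).trans ?_
      push_cast
      rw [norm_mul, norm_pow]
      gcongr
      exact mul_le_of_le_one_right (by positivity) (PadicInt.norm_le_one _)
  have hlim : Filter.Tendsto (fun N : ℕ => C * ‖(p : ℤ_[p])‖ ^ N) Filter.atTop (nhds (C * 0)) :=
    (tendsto_pow_atTop_nhds_zero_of_lt_one (norm_nonneg _) ((PadicInt.norm_lt_one_iff_dvd _).2 dvd_rfl)).const_mul C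
  rw [mul_zero] at hlim
  exact hE0.not_ge (ge_of_tendsto' hlim key)

lemma exists_norm_expSum_eq {p : ℕ} [Fact p.Prime] {k : ℕ} (hk : 0 < k) {b : Fin k → ℤ_[p]}
    (hinj : Function.Injective b) (hb : ∀ i, (p : ℤ_[p]) ^ 2 ∣ b i - 1) {d : Fin k → ℚ_[p]}
    (hd : ∀ i, d i ≠ 0) {g : ℤ_[p] → ℚ_[p]} (hg : Continuous g)
    (hgn : ∀ n : ℕ, g n = ∑ i, d i * (b i : ℚ_[p]) ^ n) (hg0 : g 0 = 0) :
    ∃ B : ℚ_[p], B ≠ 0 ∧ ∃ l, 0 < l ∧ l < k ∧ ∃ m : ℕ, ∀ y : ℤ_[p], (p : ℤ_[p]) ^ m ∣ y →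
      ‖g y‖ = ‖B‖ * ‖y‖ ^ l := by
  obtain ⟨A, C, hA⟩ := exists_hasTaylorBound_expSum hb d hg hgn
  have hex : ∃ l, l < k ∧ A l ≠ 0 := by
    by_contra! hcon
    refine not_norm_expSum_le hk hinj hb hd hgn C fun y => ?_
    have := hA k y
    rwa [Finset.sum_eq_zero fun n hn => by rw [hcon n (Finset.mem_range.1 hn), zero_mul],
      sub_zero] at this
  obtain ⟨hlk, hAl⟩ := Nat.find_spec hex
  have hmin : ∀ n < Nat.find hex, A n = 0 := fun n hn => by
    by_contra hne
    exact Nat.find_min hex hn ⟨hn.trans hlk, hne⟩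
  set l := Nat.find hex
  have hl0 : 0 < l := by
    refine Nat.pos_of_ne_zero fun h0 => hAl ?_
    rw [h0]
    simpa [hg0] using hA 1 0
  have hlim : Filter.Tendsto (fun N : ℕ => C * ‖(p : ℤ_[p])‖ ^ N) Filter.atTop (nhds (C * 0)) :=
    (tendsto_pow_atTop_nhds_zero_of_lt_one (norm_nonneg _) ((PadicInt.norm_lt_one_iff_dvd _).2 dvd_rfl)).const_mul C
  rw [mul_zero] at hlim
  obtain ⟨m, hm⟩ := (hlim.eventually_lt_const (norm_pos_iff.2 hAl)).exists
  have hC0 : 0 ≤ C := by simpa using (norm_nonneg _).trans (hA 0 1)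
  refine ⟨A l, hAl, l, hl0, hlk, m, fun y hy => ?_⟩
  rcases eq_or_ne y 0 with rfl | hy0
  · simp [hg0, hl0.ne']
  have hle : ‖g y - A l * (y : ℚ_[p]) ^ l‖ ≤ C * ‖y‖ ^ (l + 1) := by
    have := hA (l + 1) y
    rwa [Finset.sum_range_succ, Finset.sum_eq_zero fun n hn => by
      rw [hmin n (Finset.mem_range.1 hn), zero_mul], zero_add] at this
  have hyn : ‖y‖ ≤ ‖(p : ℤ_[p])‖ ^ m := by
    obtain ⟨w, rfl⟩ := hy
    rw [norm_mul, norm_pow]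
    exact mul_le_of_le_one_right (by positivity) (PadicInt.norm_le_one _)
  have hmain : ‖A l * (y : ℚ_[p]) ^ l‖ = ‖A l‖ * ‖y‖ ^ l := by simp
  have hlt : ‖g y - A l * (y : ℚ_[p]) ^ l‖ < ‖A l * (y : ℚ_[p]) ^ l‖ := by
    rw [hmain]
    refine hle.trans_lt ?_
    have hypos : 0 < ‖y‖ ^ l := pow_pos (norm_pos_iff.2 hy0) l
    calc C * ‖y‖ ^ (l + 1) = C * ‖y‖ * ‖y‖ ^ l := by ring
      _ < ‖A l‖ * ‖y‖ ^ l := by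
        refine mul_lt_mul_of_pos_right (lt_of_le_of_lt ?_ hm) hypos
        gcongr
  rw [← hmain, ← sub_add_cancel (g y) (A l * (y : ℚ_[p]) ^ l),
    IsUltrametricDist.norm_add_eq_max_of_norm_ne_norm hlt.ne, max_eq_right hlt.le]

lemma exists_expSum_translate {p : ℕ} [Fact p.Prime] {ι : Type*} [Fintype ι] {a : ι → ℤ_[p]}
    (ha : ∀ i, ‖a i‖ = 1) (c : ι → ℚ_[p]) {f : ℤ_[p] → ℚ_[p]} (hf : Continuous f)
    (hfn : ∀ n : ℕ, f n = ∑ i, c i * (a i : ℚ_[p]) ^ n) (x : ℤ_[p]) :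
    ∃ e : ι → ℤ_[p], (∀ i, ‖e i‖ = 1) ∧
      ∀ n : ℕ, f (x + n) = ∑ i, c i * (e i : ℚ_[p]) * (a i : ℚ_[p]) ^ n := by
  obtain ⟨z, hz, hzx⟩ := mem_closure_iff_seq_limit.1 (PadicInt.denseRange_natCast x)
  choose r hr using hz
  obtain ⟨e, s, hs, hlim⟩ := CompactSpace.tendsto_subseq fun q i => a i ^ r q
  have hlim' := tendsto_pi_nhds.1 hlim
  refine ⟨e, fun i => ?_, fun n => ?_⟩
  · refine tendsto_nhds_unique (hlim' i).norm ?_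
    simp [ha]
  · have h1 : Filter.Tendsto (fun q => f (z (s q) + n)) Filter.atTop (nhds (f (x + n))) :=
      (hf.tendsto _).comp ((hzx.comp hs.tendsto_atTop).add_const _)
    refine tendsto_nhds_unique h1 ?_
    have h2 : ∀ q, f (z (s q) + n) =
        ∑ i, c i * ((a i ^ r (s q) : ℤ_[p]) : ℚ_[p]) * (a i : ℚ_[p]) ^ n := fun q => by
      rw [← hr, ← Nat.cast_add, hfn]
      exact Finset.sum_congr rfl fun i _ => by push_cast; ring
    simp_rw [h2]
    exact tendsto_finsetSum _ fun i _ =>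
      (((continuous_subtype_val.tendsto _).comp (hlim' i)).const_mul _).mul_const _

lemma Padic.valuation_eq_of_norm_eq {p : ℕ} [Fact p.Prime] {x y : ℚ_[p]} (hx : x ≠ 0)
    (h : ‖x‖ = ‖y‖) : x.valuation = y.valuation := by
  have hy : y ≠ 0 := norm_ne_zero_iff.1 (h ▸ norm_ne_zero_iff.2 hx)
  rw [Padic.norm_eq_zpow_neg_valuation hx, Padic.norm_eq_zpow_neg_valuation hy] at h
  have hp1 : (1 : ℝ) < p := by exact_mod_cast (Fact.out : p.Prime).one_lt
  have := (zpow_right_injective₀ (by positivity) hp1.ne') h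
  omega

theorem stmt7 (p : ℕ) [Fact p.Prime] (k : ℕ) (hk : 2 ≤ k)
    (a : Fin k → ℤ_[p]) (ha_inj : Function.Injective a)
    (ha_one : ∀ i, (p : ℤ_[p]) ∣ (a i - 1))
    (hp2 : p = 2 → ∀ i j, a i ≠ - a j)
    (c : Fin k → ℚ_[p]) (hc : ∀ i, c i ≠ 0)
    (f : ℤ_[p] → ℚ_[p]) (hf : Continuous f)
    (hfn : ∀ n : ℕ, f (n : ℤ_[p]) = ∑ i, c i * ((a i ^ n : ℤ_[p]) : ℚ_[p]))
    (x₀ : ℤ_[p]) (hx₀ : f x₀ = 0) :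
    (∃ α : ℤ, ∃ l : ℕ, 0 < l ∧ l < k ∧ ∃ m : ℕ,
      ∀ t : ℤ_[p], (p : ℤ_[p]) ^ m ∣ (t - x₀) → t ≠ x₀ →
        vpQp p (f t) = (α : WithTop ℤ) + ((l : ℤ) : WithTop ℤ) * vpZp p (t - x₀)) ∧
    -- in particular, x₀ is an isolated zero of f
    ∃ U ∈ nhds x₀, ∀ x ∈ U, f x = 0 → x = x₀ := by
  have hnorm : ∀ i, ‖a i‖ = 1 := fun i => by
    have hlt : ‖a i - 1‖ < 1 := (PadicInt.norm_lt_one_iff_dvd _).2 (ha_one i)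
    rw [← sub_add_cancel (a i) 1,
      IsUltrametricDist.norm_add_eq_max_of_norm_ne_norm (by rw [norm_one]; exact hlt.ne),
      norm_one, max_eq_right hlt.le]
  obtain ⟨e, he, hen⟩ := exists_expSum_translate hnorm c hf (by simpa using hfn) x₀
  have hp0 : (p : ℤ_[p]) ≠ 0 := PadicInt.prime_p.ne_zero
  obtain ⟨B, hB, l, hl0, hlk, m, hm⟩ := exists_norm_expSum_eq (p := p) (k := k) (by omega)
    (b := fun i => a i ^ p) (d := fun i => c i * (e i : ℚ_[p])) (g := fun y => f (x₀ + p * y))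
    (fun i j hij => by
      by_contra hne
      exact PadicInt.pow_prime_ne_pow_prime (ha_one i) (ha_one j) (ha_inj.ne hne)
        (fun h => hp2 h i j) hij)
    (fun i => PadicInt.sq_dvd_pow_prime_sub_one (ha_one i))
    (fun i => mul_ne_zero (hc i) (norm_ne_zero_iff.1 (by simp [he])))
    (by fun_prop)
    (fun n => by
      have := hen (p * n)
      push_cast at this ⊢
      simpa only [pow_mul] using this)
    (by simpa using hx₀)
  have hval : ∀ t : ℤ_[p], (p : ℤ_[p]) ^ (m + 1) ∣ t - x₀ → t ≠ x₀ →
      f t ≠ 0 ∧ (f t).valuation = B.valuation - l + l * ((t - x₀).valuation : ℤ) := by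
    rintro t ⟨w, hw⟩ ht
    obtain ⟨y, hy⟩ : ∃ y, y = (p : ℤ_[p]) ^ m * w := ⟨_, rfl⟩
    have hty : t - x₀ = p * y := by rw [hw, hy]; ring
    have hy0 : y ≠ 0 := by
      rintro rfl
      exact ht (sub_eq_zero.1 (by simpa using hty))
    have h := hm y (hy ▸ dvd_mul_right _ _)
    simp only [← hty, add_sub_cancel] at h
    have hyQ : (y : ℚ_[p]) ≠ 0 := by simpa using hy0
    have h' : ‖f t‖ = ‖B * (y : ℚ_[p]) ^ l‖ := by simpa using h
    have hft : f t ≠ 0 := by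
      rw [← norm_ne_zero_iff, h', norm_ne_zero_iff]
      exact mul_ne_zero hB (pow_ne_zero _ hyQ)
    refine ⟨hft, ?_⟩
    rw [Padic.valuation_eq_of_norm_eq hft h', Padic.valuation_mul hB (pow_ne_zero _ hyQ),
      Padic.valuation_pow, hty, PadicInt.valuation_coe, PadicInt.valuation_mul hp0 hy0,
      PadicInt.valuation_p]
    push_cast
    ring
  refine ⟨⟨B.valuation - l, l, hl0, hlk, m + 1, fun t ht hne => ?_⟩,
    {t | (p : ℤ_[p]) ^ (m + 1) ∣ t - x₀}, ?_, fun x hx hfx => ?_⟩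
  · obtain ⟨h0, h⟩ := hval t ht hne
    rw [vpQp, vpZp, if_neg h0, if_neg (sub_ne_zero.2 hne), h]
    norm_cast
  · have hpos : (0 : ℝ) < (p : ℝ) ^ (-((m + 1 : ℕ) : ℤ)) :=
      zpow_pos (by exact_mod_cast (Fact.out : p.Prime).pos) _
    filter_upwards [Metric.ball_mem_nhds x₀ hpos] with t ht
    rw [Metric.mem_ball, dist_eq_norm] at ht
    exact Ideal.mem_span_singleton.1 ((PadicInt.norm_le_pow_iff_mem_span_pow _ _).1 ht.le)
  · by_contra hne
    exact (hval x hx hne).1 hfx
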